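/- Constant profiles corollary. Fix an injective computable enumeration q_0, q_1, … of ℚ ∩ (1,2). There exist a limit computable set A ⊆ ℕ and sets B_{q_0}, B_{q_1}, … ⊆ ℕ such that B_{q_i} ≡_bfo A for every i ∈ ℕ, and for all i, j: B_{q_i} ≤₁ B_{q_j} if and only if q_i ≤ q_j (hence B_{q_i} <₁ B_{q_j} if and only if q_i < q_j). Consequently the map q ↦ deg₁(B_q) is an order-embedding of (ℚ ∩ (1,2), ≤) into the partially ordered set of 1-degrees contained in the bounded finite-one degree of A, so this bounded finite-one degree contains a copy of (ℚ, ≤). -/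

import Mathlib

/-- One-one reducibility: `B ≤₁ C` via a total computable injective function. -/
def OneOneRed (B C : Set ℕ) : Prop :=
  ∃ f : ℕ → ℕ, Computable f ∧ Function.Injective f ∧ ∀ x, x ∈ B ↔ f x ∈ C

/-- Strict one-one reducibility: `B <₁ C`. -/
def OneOneLt (B C : Set ℕ) : Prop :=
  OneOneRed B C ∧ ¬ OneOneRed C B

/-- Bounded finite-one reducibility: `B ≤_bfo C` via a total computable function
all of whose fibers have size at most some constant `c ≥ 1`. -/
def BfoRed (B C : Set ℕ) : Prop :=
  ∃ f : ℕ → ℕ, Computable f ∧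
    (∃ c : ℕ, 1 ≤ c ∧ ∀ y, {x | f x = y}.encard ≤ (c : ℕ∞)) ∧
    ∀ x, x ∈ B ↔ f x ∈ C

/-- Bounded finite-one equivalence: `B ≡_bfo C`. -/
def BfoEquiv (B C : Set ℕ) : Prop :=
  BfoRed B C ∧ BfoRed C B

/-- `A` is limit computable (equivalently `A ≤_T ∅'`, i.e. `Δ⁰₂`). -/
def LimitComputable (A : Set ℕ) : Prop :=
  ∃ g : ℕ → ℕ → Bool, Computable₂ g ∧
    ∀ n, ∃ s₀, ∀ s, s₀ ≤ s → (g s n = true ↔ n ∈ A)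

/-- `a_k`, the left endpoint of the `k`-th block `I_k = [a_k, a_{k+1})`;
`a_0 = 0` and `a_{k+1} = a_k + k!`. -/
def blockStart (k : ℕ) : ℕ := ∑ m ∈ Finset.range k, Nat.factorial m

open Nat.Partrec (Code)
open Nat.Partrec.Code (evaln eval)

namespace CProf

/-! ### A rigid limit computable set -/

/-- A candidate disagreement at `x ≥ m`, seen within `s` steps. -/
def cand (s : ℕ) (c : Code) (m x : ℕ) : Option (ℕ × ℕ) :=
  (evaln s c x).bind fun y => if m ≤ x ∧ y ≠ x then some (x, y) else none

/-- The least candidate below a bound. -/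
def srch (s : ℕ) (c : Code) (m b : ℕ) : Option (ℕ × ℕ) :=
  Nat.rec none (fun x ih => (ih <|> cand s c m x)) b

/-- Update of the finite state `(m, L)`: `A ∩ [0,m) = L`. -/
def upd (p : ℕ × List ℕ) (o : Option (ℕ × ℕ)) : ℕ × List ℕ :=
  Option.casesOn o (p.1 + 1, p.2)
    (fun xy => (p.1 + xy.1 + xy.2 + 1, if ∃ a ∈ p.2, a = xy.2 then p.2 else xy.1 :: p.2))

/-- State after `n` requirements in the stage `s` approximation. -/
def state (s n : ℕ) : ℕ × List ℕ :=
  Nat.rec (1, []) (fun k p => upd p (srch s (Denumerable.ofNat Code k) p.1 s)) n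

theorem cand_primrec : Primrec fun a : ((ℕ × Code) × ℕ) × ℕ => cand a.1.1.1 a.1.1.2 a.1.2 a.2 := by
  unfold cand
  refine Primrec.option_bind ?_ ?_
  · exact Nat.Partrec.Code.primrec_evaln.comp ((Primrec.fst.comp Primrec.fst).pair Primrec.snd)
  · refine Primrec.ite ?_ ?_ (Primrec.const none)
    · refine PrimrecPred.and ?_ (PrimrecPred.not ?_)
      · exact Primrec.nat_le.comp (Primrec.snd.comp (Primrec.fst.comp Primrec.fst))
          (Primrec.snd.comp Primrec.fst)
      · exact Primrec.eq.comp Primrec.snd (Primrec.snd.comp Primrec.fst)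
    · exact Primrec.option_some.comp ((Primrec.snd.comp Primrec.fst).pair Primrec.snd)

theorem srch_primrec : Primrec fun a : ((ℕ × Code) × ℕ) × ℕ => srch a.1.1.1 a.1.1.2 a.1.2 a.2 := by
  unfold srch
  refine Primrec.nat_rec' (h := fun (a : ((ℕ × Code) × ℕ) × ℕ) (p : ℕ × Option (ℕ × ℕ)) =>
      (p.2 <|> cand a.1.1.1 a.1.1.2 a.1.2 p.1))
    Primrec.snd (Primrec.const none) ?_
  refine Primrec.option_orElse.comp (Primrec.snd.comp Primrec.snd) ?_
  exact cand_primrec.comp ((Primrec.fst.comp Primrec.fst).pair (Primrec.fst.comp Primrec.snd))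

theorem upd_primrec : Primrec₂ upd := by
  unfold upd
  refine Primrec.option_casesOn (o := fun a : (ℕ × List ℕ) × Option (ℕ × ℕ) => a.2)
    Primrec.snd ?_ ?_
  · exact (Primrec.succ.comp (Primrec.fst.comp Primrec.fst)).pair (Primrec.snd.comp Primrec.fst)
  · have h1 : Primrec fun a : ((ℕ × List ℕ) × Option (ℕ × ℕ)) × (ℕ × ℕ) => a.1.1.1 :=
      Primrec.fst.comp (Primrec.fst.comp Primrec.fst)
    have h2 : Primrec fun a : ((ℕ × List ℕ) × Option (ℕ × ℕ)) × (ℕ × ℕ) => a.1.1.2 :=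
      Primrec.snd.comp (Primrec.fst.comp Primrec.fst)
    have h3 : Primrec fun a : ((ℕ × List ℕ) × Option (ℕ × ℕ)) × (ℕ × ℕ) => a.2.1 :=
      Primrec.fst.comp Primrec.snd
    have h4 : Primrec fun a : ((ℕ × List ℕ) × Option (ℕ × ℕ)) × (ℕ × ℕ) => a.2.2 :=
      Primrec.snd.comp Primrec.snd
    refine Primrec.pair (Primrec.succ.comp (Primrec.nat_add.comp (Primrec.nat_add.comp h1 h3) h4)) ?_
    refine Primrec.ite ?_ h2 (Primrec.list_cons.comp h3 h2)
    exact (PrimrecRel.exists_mem_list (R := fun a b : ℕ => a = b) Primrec.eq).comp h2 h4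

theorem state_primrec : Primrec₂ state := by
  unfold state
  refine Primrec.nat_rec' (f := fun a : ℕ × ℕ => a.2) (g := fun _ => ((1, []) : ℕ × List ℕ))
    (h := fun a p => upd p.2 (srch a.1 (Denumerable.ofNat Code p.1) p.2.1 a.1))
    Primrec.snd (Primrec.const _) ?_
  have h1 : Primrec fun a : (ℕ × ℕ) × (ℕ × (ℕ × List ℕ)) => a.1.1 := Primrec.fst.comp Primrec.fst
  have h2 : Primrec fun a : (ℕ × ℕ) × (ℕ × (ℕ × List ℕ)) => Denumerable.ofNat Code a.2.1 :=
    (Primrec.ofNat Code).comp (Primrec.fst.comp Primrec.snd)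
  have h3 : Primrec fun a : (ℕ × ℕ) × (ℕ × (ℕ × List ℕ)) => a.2.2 := Primrec.snd.comp Primrec.snd
  exact upd_primrec.comp h3 (srch_primrec.comp (((h1.pair h2).pair (Primrec.fst.comp h3)).pair h1))

theorem cand_eq_some {s c m x p} : cand s c m x = some p ↔
    p.1 = x ∧ m ≤ x ∧ p.2 ≠ x ∧ p.2 ∈ evaln s c x := by
  obtain ⟨a, b⟩ := p
  simp only [cand, Option.bind_eq_some_iff, Option.mem_def]
  constructor
  · rintro ⟨y, hy, h⟩
    split_ifs at h with h'
    simp only [Option.some.injEq, Prod.mk.injEq] at h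
    obtain ⟨rfl, rfl⟩ := h
    exact ⟨rfl, h'.1, h'.2, hy⟩
  · rintro ⟨h1, h2, h3, h4⟩
    refine ⟨b, h4, ?_⟩
    subst h1
    simp [h2, h3]

theorem cand_mono {s t c m x p} (h : s ≤ t) (hc : cand s c m x = some p) :
    cand t c m x = some p := by
  rw [cand_eq_some] at *
  exact ⟨hc.1, hc.2.1, hc.2.2.1, Nat.Partrec.Code.evaln_mono h hc.2.2.2⟩

theorem srch_succ (s c m b) : srch s c m (b + 1) = (srch s c m b <|> cand s c m b) := rfl

theorem srch_none {s c m b} (h : ∀ x < b, cand s c m x = none) : srch s c m b = none := by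
  induction b with
  | zero => rfl
  | succ b ih => rw [srch_succ, ih (fun x hx => h x (by omega)), h b (by omega)]; rfl

theorem srch_some {s c m x p b} (h : ∀ z < x, cand s c m z = none) (hx : cand s c m x = some p)
    (hb : x < b) : srch s c m b = some p := by
  induction b, hb using Nat.le_induction with
  | base => rw [srch_succ, srch_none h, hx]; rfl
  | succ b _ ih => rw [srch_succ, ih]; rfl

/-- The search stabilizes. -/
theorem srch_lim (c : Code) (m : ℕ) : ∃ o : Option (ℕ × ℕ),
    (∃ s₀, ∀ s, s₀ ≤ s → srch s c m s = o) ∧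
    (o = none → ∀ x y, m ≤ x → y ≠ x → y ∉ eval c x) ∧
    (∀ p, o = some p → m ≤ p.1 ∧ p.2 ≠ p.1 ∧ p.2 ∈ eval c p.1) := by
  classical
  by_cases h : ∃ x, ∃ s p, cand s c m x = some p
  · obtain ⟨s, p, hp⟩ := Nat.find_spec h
    have hmin := fun z => Nat.find_min (m := z) h
    set x := Nat.find h
    refine ⟨some p, ⟨max s (x + 1), fun t ht => ?_⟩, by simp, ?_⟩
    · refine srch_some (x := x) (fun z hz => ?_) (cand_mono (by omega) hp) (by omega)
      have := hmin z hz
      push Not at this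
      exact Option.eq_none_iff_forall_ne_some.2 (this t)
    · rintro _ ⟨⟩
      obtain ⟨h1, h2, h3, h4⟩ := cand_eq_some.1 hp
      rw [h1]
      exact ⟨h2, h3, Nat.Partrec.Code.evaln_sound h4⟩
  · push Not at h
    refine ⟨none, ⟨0, fun s _ => srch_none fun x _ =>
      Option.eq_none_iff_forall_ne_some.2 (h x s)⟩, fun _ x y hm hy he => ?_, by simp⟩
    obtain ⟨s, hs⟩ := Nat.Partrec.Code.evaln_complete.1 he
    exact h x s (x, y) (cand_eq_some.2 ⟨rfl, hm, hy, hs⟩)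

theorem state_lim (n : ℕ) : ∃ p, ∃ s₀, ∀ s, s₀ ≤ s → state s n = p := by
  induction n with
  | zero => exact ⟨_, 0, fun _ _ => rfl⟩
  | succ n ih =>
    obtain ⟨p, s₀, hs⟩ := ih
    obtain ⟨o, ⟨s₁, hs₁⟩, -⟩ := srch_lim (Denumerable.ofNat Code n) p.1
    refine ⟨upd p o, max s₀ s₁, fun s h => ?_⟩
    have : state s (n + 1) =
      upd (state s n) (srch s (Denumerable.ofNat Code n) (state s n).1 s) := rfl
    rw [this, hs s (by omega), hs₁ s (by omega)]

/-- The limit state. -/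
noncomputable def lim (n : ℕ) : ℕ × List ℕ := (state_lim n).choose

theorem lim_spec (n : ℕ) : ∃ s₀, ∀ s, s₀ ≤ s → state s n = lim n := (state_lim n).choose_spec

theorem lim_zero : lim 0 = (1, []) := by
  obtain ⟨s, h⟩ := lim_spec 0
  exact (h s le_rfl).symm

theorem lim_succ (n : ℕ) : ∃ o, lim (n + 1) = upd (lim n) o ∧
    (o = none → ∀ x y, (lim n).1 ≤ x → y ≠ x → y ∉ eval (Denumerable.ofNat Code n) x) ∧
    (∀ p, o = some p → (lim n).1 ≤ p.1 ∧ p.2 ≠ p.1 ∧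
      p.2 ∈ eval (Denumerable.ofNat Code n) p.1) := by
  obtain ⟨o, ⟨s₁, h1⟩, h2⟩ := srch_lim (Denumerable.ofNat Code n) (lim n).1
  refine ⟨o, ?_, h2⟩
  obtain ⟨s₂, h3⟩ := lim_spec n
  obtain ⟨s₃, h4⟩ := lim_spec (n + 1)
  let s := max s₁ (max s₂ s₃)
  have : state s (n + 1) =
      upd (state s n) (srch s (Denumerable.ofNat Code n) (state s n).1 s) := rfl
  rw [h4 s (by omega), h3 s (by omega), h1 s (by omega)] at this
  exact this

theorem lim_step (n : ℕ) : (lim n).1 < (lim (n + 1)).1 ∧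
    ∀ x < (lim n).1, x ∈ (lim (n + 1)).2 ↔ x ∈ (lim n).2 := by
  obtain ⟨o, h, -, h2⟩ := lim_succ n
  rw [h]
  cases o with
  | none => simp [upd]
  | some p =>
    obtain ⟨h3, -⟩ := h2 p rfl
    refine ⟨by simp only [upd]; omega, fun x hx => ?_⟩
    simp only [upd]
    split_ifs
    · rfl
    · have : x ≠ p.1 := by omega
      simp [this]

theorem lim_bound (n : ℕ) : ∀ x ∈ (lim n).2, x < (lim n).1 := by
  induction n with
  | zero => simp [lim_zero]
  | succ n ih =>
    obtain ⟨o, h, -, h2⟩ := lim_succ n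
    rw [h]
    intro x hx
    cases o with
    | none => simp only [upd] at hx ⊢; have := ih x hx; omega
    | some p =>
      simp only [upd] at hx ⊢
      split_ifs at hx
      · have := ih x hx; omega
      · rcases List.mem_cons.1 hx with rfl | hx
        · omega
        · have := ih x hx; omega

theorem lim_gt (n : ℕ) : n < (lim n).1 := by
  induction n with
  | zero => simp [lim_zero]
  | succ n ih => have := (lim_step n).1; omega

theorem lim_stable {n k : ℕ} (h : n ≤ k) : (lim n).1 ≤ (lim k).1 ∧
    ∀ x < (lim n).1, x ∈ (lim k).2 ↔ x ∈ (lim n).2 := by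
  induction k, h using Nat.le_induction with
  | base => simp
  | succ k _ ih =>
    have := lim_step k
    exact ⟨by omega, fun x hx => (this.2 x (by omega)).trans (ih.2 x hx)⟩

/-- The rigid set. -/
def rigid : Set ℕ := {n | n ∈ (lim (n + 1)).2}

theorem mem_rigid {x n : ℕ} (h : x < (lim n).1) : x ∈ rigid ↔ x ∈ (lim n).2 := by
  have h' : x < (lim (x + 1)).1 := by have := lim_gt (x + 1); omega
  change x ∈ (lim (x + 1)).2 ↔ _
  rcases le_total n (x + 1) with hn | hn
  · exact (lim_stable hn).2 x h
  · exact ((lim_stable hn).2 x h').symm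

theorem zero_notMem : 0 ∉ rigid := by
  rw [mem_rigid (n := 0) (lim_gt 0), lim_zero]; simp

/-- Membership in the stage `s` approximation. -/
theorem approx_primrec :
    PrimrecPred fun a : ℕ × ℕ => ∃ b ∈ (state a.1 (a.2 + 1)).2, b = a.2 :=
  (PrimrecRel.exists_mem_list (R := fun a b : ℕ => a = b) Primrec.eq).comp
    (Primrec.snd.comp (state_primrec.comp Primrec.fst (Primrec.succ.comp Primrec.snd)))
    Primrec.snd

theorem rigid_spec (F : ℕ → ℕ) (hF : Computable F) (h : ∀ z, z ∈ rigid ↔ F z ∈ rigid) :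
    ∃ m, ∀ z, m ≤ z → F z = z := by
  obtain ⟨c, hc⟩ := Nat.Partrec.Code.exists_code.1 (Partrec.nat_iff.1 hF.partrec)
  obtain ⟨o, h1, h2, h3⟩ := lim_succ (Encodable.encode c)
  rw [Denumerable.ofNat_encode] at h2 h3
  have hev : ∀ x y, y ∈ eval c x ↔ y = F x := by
    intro x y
    rw [hc]
    simp
  cases o with
  | none =>
    refine ⟨(lim (Encodable.encode c)).1, fun z hz => ?_⟩
    by_contra hne
    exact h2 rfl z (F z) hz hne ((hev _ _).2 rfl)
  | some p =>
    exfalso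
    obtain ⟨h4, h5, h6⟩ := h3 p rfl
    rw [hev] at h6
    have h7 := h p.1
    rw [← h6, mem_rigid (n := Encodable.encode c + 1) (by rw [h1]; simp only [upd]; omega),
      mem_rigid (n := Encodable.encode c + 1) (by rw [h1]; simp only [upd]; omega), h1] at h7
    simp only [upd] at h7
    have hx : p.1 ∉ (lim (Encodable.encode c)).2 := fun hx => by
      have := lim_bound _ _ hx; omega
    split_ifs at h7 with h8
    · simp at h8
      exact hx (h7.2 h8)
    · simp at h8
      simp [h5, h8] at h7

/-! ### The sets `B_r` -/

/-- The decidable sets of duplicated points. -/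
def D (r : ℚ) (z : ℕ) : Prop :=
  z.unpair.1 * r.den < r.num.toNat * z.unpair.2.unpair.1

instance (r : ℚ) : DecidablePred (D r) := fun z => by unfold D; infer_instance

theorem D_primrec (r : ℚ) : PrimrecPred (D r) := by
  have h1 : Primrec fun z : ℕ => z.unpair.1 := Primrec.fst.comp Primrec.unpair
  have h2 : Primrec fun z : ℕ => z.unpair.2 := Primrec.snd.comp Primrec.unpair
  exact Primrec.nat_lt.comp (Primrec.nat_mul.comp h1 (Primrec.const _))
    (Primrec.nat_mul.comp (Primrec.const _) (h1.comp h2))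

theorem D_iff {r : ℚ} (hr : 0 < r) (z : ℕ) :
    D r z ↔ (z.unpair.1 : ℚ) < r * (z.unpair.2.unpair.1 : ℚ) := by
  have hn : ((r.num.toNat : ℕ) : ℚ) = r * r.den := by
    have h : ((r.num.toNat : ℕ) : ℤ) = r.num := Int.toNat_of_nonneg (Rat.num_nonneg.2 hr.le)
    have h' : ((r.num.toNat : ℕ) : ℚ) = (r.num : ℚ) := by exact_mod_cast h
    rw [h', Rat.mul_den_eq_num]
  have hd : (0 : ℚ) < r.den := by exact_mod_cast r.den_pos
  unfold D
  rw [← Nat.cast_lt (α := ℚ)]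
  push_cast
  rw [hn, mul_right_comm, mul_lt_mul_iff_left₀ hd]

theorem D_mono {r t : ℚ} (hr : 0 < r) (h : r ≤ t) {z : ℕ} (hz : D r z) : D t z := by
  rw [D_iff hr] at hz
  rw [D_iff (hr.trans_le h)]
  exact hz.trans_le (by gcongr)

theorem D_diff {r t : ℚ} (hr : 0 < r) (h : r < t) (m : ℕ) :
    ∃ z, m ≤ z ∧ D t z ∧ ¬ D r z := by
  have hn : ((r.num.toNat : ℕ) : ℚ) = r * r.den := by
    have h : ((r.num.toNat : ℕ) : ℤ) = r.num := Int.toNat_of_nonneg (Rat.num_nonneg.2 hr.le)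
    have h' : ((r.num.toNat : ℕ) : ℚ) = (r.num : ℚ) := by exact_mod_cast h
    rw [h', Rat.mul_den_eq_num]
  have hd : (0 : ℚ) < r.den := by exact_mod_cast r.den_pos
  refine ⟨Nat.pair r.num.toNat (Nat.pair r.den m),
    (Nat.right_le_pair _ _).trans (Nat.right_le_pair _ _), ?_, ?_⟩
  · rw [D_iff (hr.trans h)]
    simp only [Nat.unpair_pair, hn]
    gcongr
  · rw [D_iff hr]
    simp [Nat.unpair_pair, hn]

/-- The underlying point of `rigid` of an element of the universe of `B_r`; `0` is junk. -/
def und (r : ℚ) (x : ℕ) : ℕ :=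
  if x % 3 = 0 ∨ (x % 3 = 1 ∧ D r (x / 3)) then x / 3 else 0

/-- The sets `B_r`. -/
def BB (r : ℚ) : Set ℕ := {x | und r x ∈ rigid}

/-- The set `A`. -/
def AA : Set ℕ := {x | x % 2 = 0 ∧ x / 2 ∈ rigid}

theorem real_primrec (r : ℚ) :
    PrimrecPred fun x => x % 3 = 0 ∨ (x % 3 = 1 ∧ D r (x / 3)) := by
  have h3 : Primrec fun x : ℕ => x % 3 := Primrec.nat_mod.comp Primrec.id (Primrec.const 3)
  have hd : Primrec fun x : ℕ => x / 3 := Primrec.nat_div.comp Primrec.id (Primrec.const 3)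
  exact (Primrec.eq.comp h3 (Primrec.const 0)).or
    ((Primrec.eq.comp h3 (Primrec.const 1)).and ((D_primrec r).comp hd))

theorem div3_primrec : Primrec fun x : ℕ => x / 3 :=
  Primrec.nat_div.comp Primrec.id (Primrec.const 3)

theorem und_primrec (r : ℚ) : Primrec (und r) :=
  Primrec.ite (real_primrec r) div3_primrec (Primrec.const 0)

theorem mem_BB {r : ℚ} {x : ℕ} :
    x ∈ BB r ↔ (x % 3 = 0 ∨ (x % 3 = 1 ∧ D r (x / 3))) ∧ x / 3 ∈ rigid := by
  change und r x ∈ rigid ↔ _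
  unfold und
  split_ifs with h
  · simp [h]
  · simp [h, zero_notMem]

theorem affine_primrec (a b : ℕ) : Primrec fun x : ℕ => a * x + b :=
  Primrec.nat_add.comp (Primrec.nat_mul.comp (Primrec.const a) Primrec.id) (Primrec.const b)

theorem limitComputable_AA : LimitComputable AA := by
  classical
  have h2 : Primrec fun a : ℕ × ℕ => a.2 / 2 := Primrec.nat_div.comp Primrec.snd (Primrec.const 2)
  have hp : PrimrecPred fun a : ℕ × ℕ =>
      a.2 % 2 = 0 ∧ ∃ b ∈ (state a.1 (a.2 / 2 + 1)).2, b = a.2 / 2 :=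
    (Primrec.eq.comp (Primrec.nat_mod.comp Primrec.snd (Primrec.const 2)) (Primrec.const 0)).and
      (approx_primrec.comp (Primrec.fst.pair h2))
  obtain ⟨P, hP, hPi⟩ : ∃ P : ℕ × ℕ → Prop, PrimrecPred P ∧ ∀ s n, P (s, n) ↔
      (n % 2 = 0 ∧ ∃ b ∈ (state s (n / 2 + 1)).2, b = n / 2) := ⟨_, hp, fun _ _ => Iff.rfl⟩
  refine ⟨fun s n => decide (P (s, n)), hP.decide.to_comp, fun n => ?_⟩
  obtain ⟨s₀, hs⟩ := lim_spec (n / 2 + 1)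
  refine ⟨s₀, fun s h => ?_⟩
  rw [decide_eq_true_iff, hPi, hs s h]
  simp [AA, rigid]

theorem encard_le_two {S : Set ℕ} {a b : ℕ} (h : ∀ x ∈ S, x = a ∨ x = b) :
    S.encard ≤ ((2 : ℕ) : ℕ∞) := by
  have : S ⊆ {a, b} := fun x hx => by simpa using h x hx
  exact (Set.encard_le_encard this).trans (by exact_mod_cast Set.encard_insert_le {b} a |>.trans (by rw [Set.encard_singleton]; norm_num))

theorem bfo1 (r : ℚ) : BfoRed (BB r) AA := by
  refine ⟨fun x => if x % 3 = 0 ∨ (x % 3 = 1 ∧ D r (x / 3)) then 2 * (x / 3) + 0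
    else 2 * (x / 3) + 1, ?_, ⟨2, by norm_num, fun y => ?_⟩, fun x => ?_⟩
  · exact (Primrec.ite (real_primrec r) ((affine_primrec 2 0).comp div3_primrec)
      ((affine_primrec 2 1).comp div3_primrec)).to_comp
  · by_cases hy : y % 2 = 0
    · refine encard_le_two (a := 3 * (y / 2)) (b := 3 * (y / 2) + 1) fun x hx => ?_
      simp only [Set.mem_ofPred_eq] at hx
      split_ifs at hx with h <;> omega
    · refine encard_le_two (a := 3 * (y / 2) + 2) (b := 3 * (y / 2) + 1) fun x hx => ?_
      simp only [Set.mem_ofPred_eq] at hx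
      split_ifs at hx with h
      · omega
      · have : x % 3 ≠ 0 := fun h' => h (Or.inl h')
        omega
  · rw [mem_BB]
    simp only [AA, Set.mem_ofPred_eq]
    split_ifs with h
    · simp [h]
    · simp [h]

theorem bfo2 (r : ℚ) : BfoRed AA (BB r) := by
  refine ⟨fun x => if x % 2 = 0 then 3 * (x / 2) + 0 else 3 * (x / 2) + 2, ?_,
    ⟨2, by norm_num, fun y => ?_⟩, fun x => ?_⟩
  · have hd : Primrec fun x : ℕ => x / 2 := Primrec.nat_div.comp Primrec.id (Primrec.const 2)
    exact (Primrec.ite (Primrec.eq.comp (Primrec.nat_mod.comp Primrec.id (Primrec.const 2))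
      (Primrec.const 0)) ((affine_primrec 3 0).comp hd) ((affine_primrec 3 2).comp hd)).to_comp
  · refine encard_le_two (a := 2 * (y / 3)) (b := 2 * (y / 3) + 1) fun x hx => ?_
    simp only [Set.mem_ofPred_eq] at hx
    split_ifs at hx <;> omega
  · rw [mem_BB]
    simp only [AA, Set.mem_ofPred_eq]
    split_ifs with h
    · have h1 : (3 * (x / 2) + 0) % 3 = 0 := by omega
      have h2 : (3 * (x / 2) + 0) / 3 = x / 2 := by omega
      simp only [h1, h2, h, true_and, true_or]
    · have h1 : (3 * (x / 2) + 2) % 3 = 2 := by omega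
      simp [h1, h]

theorem one_of_le {r t : ℚ} (hr : 0 < r) (h : r ≤ t) : OneOneRed (BB r) (BB t) := by
  refine ⟨fun x => if x % 3 = 0 ∨ (x % 3 = 1 ∧ D r (x / 3)) then x else 3 * x + 2, ?_, ?_, ?_⟩
  · exact (Primrec.ite (real_primrec r) Primrec.id (affine_primrec 3 2)).to_comp
  · intro x y hxy
    simp only at hxy
    split_ifs at hxy with h1 h2 h2 <;> omega
  · intro x
    simp only
    split_ifs with h1
    · rw [mem_BB, mem_BB]
      have : x % 3 = 0 ∨ (x % 3 = 1 ∧ D t (x / 3)) := h1.imp_right fun h' => ⟨h'.1, D_mono hr h h'.2⟩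
      simp only [h1, this]
    · rw [mem_BB, mem_BB]
      have h2 : (3 * x + 2) % 3 = 2 := by omega
      simp [h1, h2]

theorem le_of_one {r t : ℚ} (ht : 0 < t) (h : OneOneRed (BB r) (BB t)) : r ≤ t := by
  classical
  by_contra hlt
  push Not at hlt
  obtain ⟨f, hf, hinj, hred⟩ := h
  let w : ℕ → ℕ := fun z => bif decide (f (3 * z + 0) = 3 * z + 0) then f (3 * z + 1)
    else f (3 * z + 0)
  let F : ℕ → ℕ := fun z => bif decide (D r z ∧ ¬ D t z) then und t (w z) else z
  have h30 := (affine_primrec 3 0).to_comp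
  have h31 := (affine_primrec 3 1).to_comp
  have hw : Computable w := by
    refine Computable.cond ?_ (hf.comp h31) (hf.comp h30)
    exact (Primrec.eq (α := ℕ)).decide.to_comp.comp (hf.comp h30) h30
  have hF : Computable F :=
    Computable.cond ((D_primrec r).and (D_primrec t).not).decide.to_comp
      ((und_primrec t).to_comp.comp hw) Computable.id
  have hpres : ∀ z, z ∈ rigid ↔ F z ∈ rigid := by
    intro z
    by_cases hz : D r z ∧ ¬ D t z
    · have h0 : 3 * z + 0 ∈ BB r ↔ z ∈ rigid := by
        rw [mem_BB]
        have h1 : (3 * z + 0) % 3 = 0 := by omega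
        have h2 : (3 * z + 0) / 3 = z := by omega
        simp only [h1, h2, true_or, true_and]
      have h1 : 3 * z + 1 ∈ BB r ↔ z ∈ rigid := by
        rw [mem_BB]
        have h1 : (3 * z + 1) % 3 = 1 := by omega
        have h2 : (3 * z + 1) / 3 = z := by omega
        simp only [h1, h2, hz.1, and_self, or_true, true_and]
      have hwz : w z ∈ BB t ↔ z ∈ rigid := by
        by_cases hc : f (3 * z + 0) = 3 * z + 0
        · simp only [w, hc, decide_true, cond_true]
          rw [← hred, h1]
        · simp only [w, hc, decide_false, cond_false]
          rw [← hred, h0]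
      have : F z = und t (w z) := by simp only [F, hz, decide_true, cond_true, not_false_eq_true, and_self]
      rw [this]
      exact hwz.symm
    · have : F z = z := by simp only [F, hz, decide_false, cond_false]
      rw [this]
  obtain ⟨m, hm⟩ := rigid_spec F hF hpres
  obtain ⟨z, hz, hDr, hDt⟩ := D_diff ht hlt (m + 1)
  have hFz := hm z (by omega)
  have : F z = und t (w z) := by simp only [F, hDr, hDt, decide_true, cond_true, not_false_eq_true, and_self]
  rw [this] at hFz
  have hw1 : w z ≠ 3 * z := by
    by_cases hc : f (3 * z + 0) = 3 * z + 0
    · simp only [w, hc, decide_true, cond_true]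
      intro h'
      have := hinj (h'.trans hc.symm)
      omega
    · simp only [w, hc, decide_false, cond_false]
      exact hc
  unfold und at hFz
  split_ifs at hFz with h1
  · rcases h1 with h1 | ⟨h1, h2⟩
    · omega
    · rw [hFz] at h2
      exact hDt h2
  · omega

end CProf

/-- **Constant profiles corollary.**  Given an injective computable enumeration
`q_0, q_1, …` of `ℚ ∩ (1,2)`, there are a limit computable set `A` and sets
`B_{q_i}` with `B_{q_i} ≡_bfo A` for all `i`, and `B_{q_i} ≤₁ B_{q_j} ↔ q_i ≤ q_j`
(hence `B_{q_i} <₁ B_{q_j} ↔ q_i < q_j`).  Thus `q ↦ deg₁(B_q)` order-embeds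
`(ℚ ∩ (1,2), ≤)` — and hence a copy of `(ℚ, ≤)` — into the 1-degrees inside the
bounded finite-one degree of `A`. -/
theorem constant_profiles
    (q : ℕ → ℚ) (hq_comp : Computable q) (hq_inj : Function.Injective q)
    (hq_range : Set.range q = {x : ℚ | 1 < x ∧ x < 2}) :
    ∃ (A : Set ℕ) (B : ℕ → Set ℕ),
      LimitComputable A ∧
      (∀ i, BfoEquiv (B i) A) ∧
      (∀ i j, OneOneRed (B i) (B j) ↔ q i ≤ q j) ∧
      (∀ i j, OneOneLt (B i) (B j) ↔ q i < q j) := by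
  have hpos : ∀ i, 0 < q i := fun i => by
    have : q i ∈ {x : ℚ | 1 < x ∧ x < 2} := hq_range ▸ Set.mem_range_self i
    exact zero_lt_one.trans this.1
  have hle : ∀ i j, OneOneRed (CProf.BB (q i)) (CProf.BB (q j)) ↔ q i ≤ q j := fun i j =>
    ⟨CProf.le_of_one (hpos j), CProf.one_of_le (hpos i)⟩
  refine ⟨CProf.AA, fun i => CProf.BB (q i), CProf.limitComputable_AA,
    fun i => ⟨CProf.bfo1 _, CProf.bfo2 _⟩, hle, fun i j => ?_⟩
  unfold OneOneLt
  rw [hle, hle, lt_iff_le_not_ge]
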